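/- Let b and T be real vector spaces and let Λ be a finite set of nonzero linear functionals on b such that for any two distinct λ, λ′ ∈ Λ one has λ′ ≠ −λ. Suppose T is the internal direct sum of subspaces T₀ and T_λ (λ ∈ Λ). For v ∈ b let B_v : T → T be the linear endomorphism that acts as multiplication by the scalar λ(v)² on T_λ for each λ ∈ Λ and as 0 on T₀. Let A : b → End(T) be a linear map such that for every v ∈ b the endomorphisms A(v) and B_v commute. Then A(w) and B_v commute for all v, w ∈ b. -/

import Mathlib

/-- If a vector-valued linear map is annihilated pointwise by a product of two nonzero linear
functionals, then it vanishes. -/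
theorem LinearMap.eq_zero_of_mul_smul_eq_zero {K V E : Type*} [Field K] [Infinite K]
    [AddCommGroup V] [Module K V] [AddCommGroup E] [Module K E]
    {f g : V →ₗ[K] K} {h : V →ₗ[K] E} (hf : f ≠ 0) (hg : g ≠ 0)
    (H : ∀ v, (f v * g v) • h v = 0) : h = 0 := by
  have hcover : ⋃ i, ((![f.ker, g.ker, h.ker] i : Subspace K V) : Set V) = Set.univ := by
    refine Set.eq_univ_of_forall fun v => Set.mem_iUnion.mpr ?_
    rcases smul_eq_zero.mp (H v) with hv | hv
    · rcases mul_eq_zero.mp hv with hv | hv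
      · exact ⟨0, hv⟩
      · exact ⟨1, hv⟩
    · exact ⟨2, hv⟩
  obtain ⟨i, hi⟩ := Subspace.exists_eq_top_of_iUnion_eq_univ hcover
  fin_cases i
  · exact absurd (LinearMap.ker_eq_top.mp hi) hf
  · exact absurd (LinearMap.ker_eq_top.mp hi) hg
  · exact LinearMap.ker_eq_top.mp hi

/-- The component in the `j`-th summand of an endomorphism acting by scalars on each summand. -/
theorem DirectSum.IsInternal.symm_apply_of_forall_smul {ι R M : Type*} [DecidableEq ι]
    [CommRing R] [AddCommGroup M] [Module R M] {N : ι → Submodule R M}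
    (hN : DirectSum.IsInternal N) {S : Module.End R M} {c : ι → R}
    (hS : ∀ i, ∀ x ∈ N i, S x = c i • x) (j : ι) (x : M) :
    (LinearEquiv.ofBijective (DirectSum.coeLinearMap N) hN).symm (S x) j =
      c j • (LinearEquiv.ofBijective (DirectSum.coeLinearMap N) hN).symm x j := by
  set D := LinearEquiv.ofBijective (DirectSum.coeLinearMap N) hN
  have hD : ∀ i (y : N i), D (DirectSum.lof R ι (fun i => N i) i y) = y := fun i y =>
    DirectSum.coeLinearMap_lof N i y
  obtain ⟨z, rfl⟩ := D.surjective x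
  induction z using DirectSum.induction_on with
  | zero => simp
  | of i y =>
    change D.symm (S (D (DirectSum.lof R ι (fun i => N i) i y))) j =
      c j • D.symm (D (DirectSum.lof R ι (fun i => N i) i y)) j
    rw [hD, hS i y y.2, map_smul, ← hD i y, D.symm_apply_apply]
    rw [DirectSum.smul_apply]
    by_cases hij : i = j
    · subst hij
      rfl
    · rw [DirectSum.lof_eq_of, DirectSum.of_eq_of_ne _ _ _ (Ne.symm hij), smul_zero, smul_zero]
  | add u v hu hv =>
    simp only [map_add, DirectSum.add_apply, smul_add, hu, hv]

/-- Commutation with operators acting on the summands of a direct sum by the squares of linear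
functionals, no two of which are equal or opposite, passes from equal to arbitrary directions. -/
theorem DirectSum.IsInternal.commute_of_forall_sq_smul {ι K V M : Type*} [DecidableEq ι]
    [Field K] [Infinite K] [AddCommGroup V] [Module K V] [AddCommGroup M] [Module K M]
    {N : ι → Submodule K M} (hN : DirectSum.IsInternal N) {f : ι → V →ₗ[K] K}
    (hsub : ∀ i j, i ≠ j → f j - f i ≠ 0) (hadd : ∀ i j, i ≠ j → f j + f i ≠ 0)
    {B : V → Module.End K M} (hB : ∀ v i, ∀ x ∈ N i, B v x = (f i v) ^ 2 • x)
    {A : V →ₗ[K] Module.End K M} (hcomm : ∀ v, Commute (A v) (B v)) (v w : V) :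
    Commute (A w) (B v) := by
  set D := LinearEquiv.ofBijective (DirectSum.coeLinearMap N) hN
  have key : ∀ i, ∀ x ∈ N i, ∀ j, i ≠ j → ∀ u, D.symm (A u x) j = 0 := by
    intro i x hx j hij u
    let h : V →ₗ[K] N j :=
      DirectSum.component K ι (fun i => N i) j ∘ₗ D.symm.toLinearMap ∘ₗ A.flip x
    have hh : h = 0 := by
      refine LinearMap.eq_zero_of_mul_smul_eq_zero (hsub i j hij) (hadd i j hij) fun t => ?_
      have h1 : D.symm (B t (A t x)) j = (f j t) ^ 2 • D.symm (A t x) j :=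
        hN.symm_apply_of_forall_smul (hB t) j (A t x)
      have h2 : B t (A t x) = (f i t) ^ 2 • A t x := by
        have := LinearMap.congr_fun (hcomm t) x
        simp only [Module.End.mul_apply, hB t i x hx, map_smul] at this
        exact this.symm
      rw [h2, map_smul, DirectSum.smul_apply] at h1
      change ((f j t - f i t) * (f j t + f i t)) • D.symm (A t x) j = 0
      rw [show (f j t - f i t) * (f j t + f i t) = f j t ^ 2 - f i t ^ 2 by ring, sub_smul, h1,
        sub_self]
    exact LinearMap.congr_fun hh u
  refine LinearMap.ext fun x => ?_
  have hx : x ∈ ⨆ i, N i := hN.submodule_iSup_eq_top ▸ Submodule.mem_top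
  induction hx using Submodule.iSup_induction' with
  | mem i x hx =>
    rw [Module.End.mul_apply, Module.End.mul_apply, hB v i x hx, map_smul]
    apply D.symm.injective
    refine DFinsupp.ext fun j => ?_
    have h1 : D.symm (B v (A w x)) j = (f j v) ^ 2 • D.symm (A w x) j :=
      hN.symm_apply_of_forall_smul (hB v) j (A w x)
    rw [h1, map_smul, DirectSum.smul_apply]
    by_cases hij : i = j
    · rw [hij]
    · rw [key i x hx j hij w, smul_zero, smul_zero]
  | zero => simp
  | add x y _ _ hx hy => rw [map_add, map_add, hx, hy]

open Classical in
/-- Let `b`, `T` be real vector spaces and `Λ` a finite set of nonzero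
linear functionals on `b` such that distinct members of `Λ` are never opposite. Suppose
`T` is the internal direct sum of `T₀` and the `T_λ` (`λ ∈ Λ`). For `v ∈ b` let `B v`
be the endomorphism acting by `λ(v)²` on `T_λ` and by `0` on `T₀`. If `A : b → End(T)`
is linear and `A v` commutes with `B v` for every `v`, then `A w` commutes with `B v`
for all `v, w`. -/
theorem commute_of_commute_same_direction {b T : Type*}
    [AddCommGroup b] [Module ℝ b] [AddCommGroup T] [Module ℝ T]
    (Λ : Finset (b →ₗ[ℝ] ℝ))
    (hΛ0 : ∀ l ∈ Λ, l ≠ 0)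
    (hΛopp : ∀ l ∈ Λ, ∀ l' ∈ Λ, l ≠ l' → l' ≠ -l)
    (T₀ : Submodule ℝ T) (Tfam : (b →ₗ[ℝ] ℝ) → Submodule ℝ T)
    (hdirect : DirectSum.IsInternal
      (fun i : Option {l // l ∈ Λ} => Option.elim i T₀ (fun l => Tfam l.1)))
    (B : b → Module.End ℝ T)
    (hB0 : ∀ v : b, ∀ x ∈ T₀, B v x = 0)
    (hBl : ∀ v : b, ∀ l ∈ Λ, ∀ x ∈ Tfam l, B v x = (l v) ^ 2 • x)
    (A : b →ₗ[ℝ] Module.End ℝ T)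
    (hcomm : ∀ v : b, Commute (A v) (B v)) :
    ∀ v w : b, Commute (A w) (B v) := by
  intro v w
  refine hdirect.commute_of_forall_sq_smul
    (f := fun i => Option.elim i 0 (fun l => l.1)) ?_ ?_ ?_ hcomm v w
  · rintro (_ | ⟨l, hl⟩) (_ | ⟨m, hm⟩) hij
    · exact absurd rfl hij
    · simpa using hΛ0 m hm
    · simpa using hΛ0 l hl
    · exact fun h => hij (congrArg some (Subtype.ext (sub_eq_zero.mp h).symm))
  · rintro (_ | ⟨l, hl⟩) (_ | ⟨m, hm⟩) hij
    · exact absurd rfl hij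
    · simpa using hΛ0 m hm
    · simpa using hΛ0 l hl
    · exact fun h => hΛopp l hl m hm (fun e => hij (by simp [e])) (eq_neg_of_add_eq_zero_left h)
  · rintro u (_ | ⟨l, hl⟩) x hx
    · simpa using hB0 u x hx
    · exact hBl u l hl x hx
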